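/- arXiv:1605.07303 — 3 statements merged into one kernel-verified Lean document; each statement's English description precedes it below -/
import Mathlib

section
/- Let φ : ℂ → ℂ be twice continuously differentiable, set γ = e^φ, and let u : ℂ → ℂ be twice continuously differentiable and satisfy the admittivity equation ∇·(γ∇u) = 0. Define v = e^{φ/2} ∂u, w = e^{φ/2} ∂̄u, and the potential entries Q₁₂ = −½ ∂φ and Q₂₁ = −½ ∂̄φ. Then the pair (v, w) satisfies the first-order elliptic system ∂̄v = Q₁₂ w and ∂w = Q₂₁ v. -/
/-- Partial derivative in the `x`-direction of `f : ℂ → ℂ`, viewed as a function of the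
real variables `(x, y)` via `z = x + iy`. -/
noncomputable def pdx (f : ℂ → ℂ) (z : ℂ) : ℂ := fderiv ℝ f z 1

/-- Partial derivative in the `y`-direction. -/
noncomputable def pdy (f : ℂ → ℂ) (z : ℂ) : ℂ := fderiv ℝ f z Complex.I

/-- Wirtinger derivative `∂f = ½(∂ₓf − i ∂_y f)`. -/
noncomputable def wdz (f : ℂ → ℂ) (z : ℂ) : ℂ := (pdx f z - Complex.I * pdy f z) / 2

/-- Conjugate Wirtinger derivative `∂̄f = ½(∂ₓf + i ∂_y f)`. -/
noncomputable def wdbar (f : ℂ → ℂ) (z : ℂ) : ℂ := (pdx f z + Complex.I * pdy f z) / 2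

theorem fderiv_cexp_mul_apply {E : Type*} [NormedAddCommGroup E] [NormedSpace ℝ E]
    {f g : E → ℂ} {z : E} (hf : DifferentiableAt ℝ f z) (hg : DifferentiableAt ℝ g z) (e : E) :
    fderiv ℝ (fun ζ => Complex.exp (f ζ) * g ζ) z e =
      Complex.exp (f z) * (fderiv ℝ f z e * g z + fderiv ℝ g z e) := by
  rw [(hf.hasFDerivAt.cexp.fun_mul hg.hasFDerivAt).fderiv]
  simp only [add_apply, smul_apply, smul_eq_mul]
  ring

theorem ContDiff.differentiable_fderiv_apply {E F : Type*} [NormedAddCommGroup E]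
    [NormedSpace ℝ E] [NormedAddCommGroup F] [NormedSpace ℝ F] {f : E → F}
    (hf : ContDiff ℝ 2 f) (e : E) : Differentiable ℝ (fun z => fderiv ℝ f z e) :=
  ((hf.fderiv_right (m := 1) (by norm_num)).differentiable (by norm_num)).clm_apply
    (differentiable_const e)

theorem ContDiff.fderiv_fderiv_apply_comm {E F : Type*} [NormedAddCommGroup E]
    [NormedSpace ℝ E] [NormedAddCommGroup F] [NormedSpace ℝ F] {f : E → F}
    (hf : ContDiff ℝ 2 f) (z a b : E) :
    fderiv ℝ (fun ζ => fderiv ℝ f ζ a) z b = fderiv ℝ (fun ζ => fderiv ℝ f ζ b) z a := by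
  have hd : DifferentiableAt ℝ (fderiv ℝ f) z :=
    (hf.fderiv_right (m := 1) (by norm_num)).differentiable (by norm_num) z
  have hsymm : IsSymmSndFDerivAt ℝ f z := hf.contDiffAt.isSymmSndFDerivAt (by simp)
  rw [fderiv_clm_apply hd (differentiableAt_const a),
    fderiv_clm_apply hd (differentiableAt_const b)]
  simpa using hsymm b a

/-- The Leibniz rule for `e^{φ/2}` times a combination
`(f + c g) / 2`. -/
theorem fderiv_cexp_half_mul_apply {φ f g : ℂ → ℂ} {z : ℂ} (hφ : DifferentiableAt ℝ φ z)
    (hf : DifferentiableAt ℝ f z) (hg : DifferentiableAt ℝ g z) (c e : ℂ) :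
    fderiv ℝ (fun ζ => Complex.exp (φ ζ / 2) * ((f ζ + c * g ζ) / 2)) z e =
      Complex.exp (φ z / 2) * (fderiv ℝ φ z e / 2 * ((f z + c * g z) / 2) +
        (fderiv ℝ f z e + c * fderiv ℝ g z e) / 2) := by
  have half : ∀ {h : ℂ → ℂ}, DifferentiableAt ℝ h z →
      fderiv ℝ (fun ζ => h ζ / 2) z e = fderiv ℝ h z e / 2 := by
    intro h hh
    simp only [div_eq_mul_inv]
    rw [fderiv_mul_const hh]
    simp [mul_comm]
  have hcg : DifferentiableAt ℝ (fun ζ => c * g ζ) z := hg.const_mul c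
  have hsum : DifferentiableAt ℝ (fun ζ => f ζ + c * g ζ) z := hf.fun_add hcg
  have hφ₂ : DifferentiableAt ℝ (fun ζ => φ ζ / 2) z := by fun_prop
  have hsum₂ : DifferentiableAt ℝ (fun ζ => (f ζ + c * g ζ) / 2) z := by fun_prop
  rw [fderiv_cexp_mul_apply hφ₂ hsum₂, half hφ, half hsum, fderiv_fun_add hf hcg,
    fderiv_const_mul hg]
  simp

/-- If `γ = e^φ` and `u` solves the admittivity equation `∇·(γ∇u) = 0`, then
`v = e^{φ/2} ∂u` and `w = e^{φ/2} ∂̄u` solve the first-order elliptic system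
`∂̄v = Q₁₂ w`, `∂w = Q₂₁ v` with `Q₁₂ = −½∂φ`, `Q₂₁ = −½∂̄φ`. -/
theorem first_order_system_of_admittivity (φ γ u v w Q₁₂ Q₂₁ : ℂ → ℂ)
    (hφ : ContDiff ℝ 2 φ) (hγ : γ = fun z => Complex.exp (φ z))
    (hu : ContDiff ℝ 2 u)
    (hadm : ∀ z : ℂ, pdx (fun ζ => γ ζ * pdx u ζ) z + pdy (fun ζ => γ ζ * pdy u ζ) z = 0)
    (hv : v = fun z => Complex.exp (φ z / 2) * wdz u z)
    (hw : w = fun z => Complex.exp (φ z / 2) * wdbar u z)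
    (hQ12 : Q₁₂ = fun z => -(1 / 2 : ℂ) * wdz φ z)
    (hQ21 : Q₂₁ = fun z => -(1 / 2 : ℂ) * wdbar φ z) :
    ∀ z : ℂ, wdbar v z = Q₁₂ z * w z ∧ wdz w z = Q₂₁ z * v z := by
  subst hγ hv hw hQ12 hQ21
  intro z
  have hφz : DifferentiableAt ℝ φ z := hφ.differentiable (by norm_num) z
  have hx := hu.differentiable_fderiv_apply 1 z
  have hy := hu.differentiable_fderiv_apply Complex.I z
  have hcomm := hu.fderiv_fderiv_apply_comm z 1 Complex.I
  have h := hadm z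
  simp only [pdx, pdy] at h
  rw [fderiv_cexp_mul_apply hφz hx, fderiv_cexp_mul_apply hφz hy, ← mul_add] at h
  replace h := (mul_eq_zero.mp h).resolve_left (Complex.exp_ne_zero _)
  simp only [wdbar, wdz, pdx, pdy, sub_eq_add_neg, ← neg_mul]
  simp only [fderiv_cexp_half_mul_apply hφz hx hy, hcomm]
  constructor <;>
    linear_combination Complex.exp (φ z / 2) / 4 * h - Complex.exp (φ z / 2) / 4 *
      (fderiv ℝ φ z Complex.I * fderiv ℝ u z Complex.I +
        fderiv ℝ (fun ζ => fderiv ℝ u ζ Complex.I) z Complex.I) * Complex.I_sq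
end

section
/- Let φ : ℂ → ℂ be twice continuously differentiable, γ = e^φ, and let u₁ : ℂ → ℂ be twice continuously differentiable with ∇·(γ∇u₁) = 0. Fix k ∈ ℂ and define M₁₁(z) = e^{−ikz} e^{φ(z)/2} (∂u₁)(z) and M₂₁(z) = e^{−ikz} e^{φ(z)/2} (∂̄u₁)(z), and Q₁₂ = −½ ∂φ, Q₂₁ = −½ ∂̄φ. Then for all z ∈ ℂ: ∂̄M₁₁ = Q₁₂ M₂₁ and ∂M₂₁ + ik M₂₁ = Q₂₁ M₁₁; that is, (M₁₁, M₂₁) is a solution column of the system D_k M − Q M = 0. -/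
/-- The derivative of a directional derivative of a `C²` function, in terms of its second
derivative. -/
theorem hasFDerivAt_fderiv_apply {f : ℂ → ℂ} (hf : ContDiff ℝ 2 f) (z v : ℂ) :
    HasFDerivAt (fun ζ => fderiv ℝ f ζ v) ((fderiv ℝ (fderiv ℝ f) z).flip v) z := by
  have h : DifferentiableAt ℝ (fderiv ℝ f) z :=
    (hf.fderiv_right (m := 1) (by norm_num)).differentiable (by norm_num) z
  simpa using h.hasFDerivAt.clm_apply (hasFDerivAt_const v z)

/-- The product rule for `e^{-ikζ} e^{φ(ζ)/2} g(ζ)`. -/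
theorem fderiv_exp_mul_exp_mul_apply {φ g : ℂ → ℂ} {g' : ℂ →L[ℝ] ℂ} {z : ℂ} (k : ℂ)
    (hφ : DifferentiableAt ℝ φ z) (hg : HasFDerivAt g g' z) (v : ℂ) :
    fderiv ℝ (fun ζ => Complex.exp (-(Complex.I * k * ζ)) * Complex.exp (φ ζ / 2) * g ζ) z v =
      Complex.exp (-(Complex.I * k * z)) * Complex.exp (φ z / 2) *
        (g' v + (fderiv ℝ φ z v / 2 - Complex.I * k * v) * g z) := by
  have h₁ : HasFDerivAt (fun ζ : ℂ => -(Complex.I * k * ζ))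
      (-((Complex.I * k) • ContinuousLinearMap.id ℝ ℂ)) z :=
    ((hasFDerivAt_id z).const_mul (Complex.I * k)).neg
  have h₂ : HasFDerivAt (fun ζ => φ ζ / 2) ((2⁻¹ : ℂ) • fderiv ℝ φ z) z := by
    simpa only [div_eq_mul_inv] using hφ.hasFDerivAt.mul_const (2⁻¹ : ℂ)
  have h : HasFDerivAt
      (fun ζ => Complex.exp (-(Complex.I * k * ζ)) * Complex.exp (φ ζ / 2) * g ζ) _ z :=
    (h₁.cexp.mul h₂.cexp).mul hg
  rw [h.fderiv]
  simp
  ring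

/-- The product rule for `e^{φ(ζ)} ∂_w f(ζ)`. -/
theorem fderiv_exp_mul_fderiv_apply {φ f : ℂ → ℂ} (hf : ContDiff ℝ 2 f) {z : ℂ}
    (hφ : DifferentiableAt ℝ φ z) (w v : ℂ) :
    fderiv ℝ (fun ζ => Complex.exp (φ ζ) * fderiv ℝ f ζ w) z v =
      Complex.exp (φ z) *
        (fderiv ℝ (fderiv ℝ f) z v w + fderiv ℝ φ z v * fderiv ℝ f z w) := by
  have h : HasFDerivAt (fun ζ => Complex.exp (φ ζ) * fderiv ℝ f ζ w) _ z :=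
    hφ.hasFDerivAt.cexp.mul (hasFDerivAt_fderiv_apply hf z w)
  rw [h.fderiv]
  simp
  ring

/-- If `γ = e^φ` and `u₁` solves the admittivity equation, then
`M₁₁ = e^{−ikz} e^{φ/2} ∂u₁` and `M₂₁ = e^{−ikz} e^{φ/2} ∂̄u₁` satisfy the first column of
the D-bar system `D_k M − Q M = 0`: `∂̄M₁₁ = Q₁₂ M₂₁` and `∂M₂₁ + ik M₂₁ = Q₂₁ M₁₁`. -/
theorem first_column_Dk_system (φ γ u₁ M₁₁ M₂₁ Q₁₂ Q₂₁ : ℂ → ℂ) (k : ℂ)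
    (hφ : ContDiff ℝ 2 φ) (hγ : γ = fun z => Complex.exp (φ z))
    (hu : ContDiff ℝ 2 u₁)
    (hadm : ∀ z : ℂ, pdx (fun ζ => γ ζ * pdx u₁ ζ) z + pdy (fun ζ => γ ζ * pdy u₁ ζ) z = 0)
    (hM11 : M₁₁ = fun z => Complex.exp (-(Complex.I * k * z)) * Complex.exp (φ z / 2) * wdz u₁ z)
    (hM21 : M₂₁ = fun z => Complex.exp (-(Complex.I * k * z)) * Complex.exp (φ z / 2) * wdbar u₁ z)
    (hQ12 : Q₁₂ = fun z => -(1 / 2 : ℂ) * wdz φ z)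
    (hQ21 : Q₂₁ = fun z => -(1 / 2 : ℂ) * wdbar φ z) :
    ∀ z : ℂ,
      wdbar M₁₁ z = Q₁₂ z * M₂₁ z ∧
      wdz M₂₁ z + Complex.I * k * M₂₁ z = Q₂₁ z * M₁₁ z := by
  intro z
  subst hγ hM11 hM21 hQ12 hQ21
  have hφz : DifferentiableAt ℝ φ z := hφ.differentiable (by norm_num) z
  have hsymm : fderiv ℝ (fderiv ℝ u₁) z Complex.I 1 = fderiv ℝ (fderiv ℝ u₁) z 1 Complex.I :=
    (hu.contDiffAt.isSymmSndFDerivAt (by simp)).eq _ _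
  have hpde := hadm z
  simp only [pdx, pdy] at hpde
  rw [fderiv_exp_mul_fderiv_apply hu hφz, fderiv_exp_mul_fderiv_apply hu hφz, ← mul_add] at hpde
  replace hpde := (mul_eq_zero.mp hpde).resolve_left (Complex.exp_ne_zero _)
  have hx := hasFDerivAt_fderiv_apply hu z 1
  have hy := (hasFDerivAt_fderiv_apply hu z Complex.I).const_mul Complex.I
  have hdz : HasFDerivAt (wdz u₁) _ z := (hx.sub hy).mul_const (2⁻¹ : ℂ)
  have hdbar : HasFDerivAt (wdbar u₁) _ z := (hx.add hy).mul_const (2⁻¹ : ℂ)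
  have hI := Complex.I_sq
  constructor
  · rw [wdbar, pdx, pdy, fderiv_exp_mul_exp_mul_apply k hφz hdz,
      fderiv_exp_mul_exp_mul_apply k hφz hdz]
    simp [wdz, wdbar, pdx, pdy, hsymm]
    grind
  · rw [wdz, pdx, pdy, fderiv_exp_mul_exp_mul_apply k hφz hdbar,
      fderiv_exp_mul_exp_mul_apply k hφz hdbar]
    simp [wdz, wdbar, pdx, pdy, hsymm]
    grind
end

section
/- Let φ : ℂ → ℂ be twice continuously differentiable, γ = e^φ, and let u₂ : ℂ → ℂ be twice continuously differentiable with ∇·(γ∇u₂) = 0. Fix k ∈ ℂ and define M₁₂(z) = e^{ik z̄} e^{φ(z)/2} (∂u₂)(z) and M₂₂(z) = e^{ik z̄} e^{φ(z)/2} (∂̄u₂)(z), and Q₁₂ = −½ ∂φ, Q₂₁ = −½ ∂̄φ. Then for all z ∈ ℂ: ∂̄M₁₂ − ik M₁₂ = Q₁₂ M₂₂ and ∂M₂₂ = Q₂₁ M₁₂; that is, (M₁₂, M₂₂) is a solution column of the system D_k M − Q M = 0. -/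
/-- Derivative of the product `e^a e^(b/2) w` in terms of the derivatives of its factors. -/
theorem HasFDerivAt.fderiv_cexp_mul_cexp_half_mul {a b w : ℂ → ℂ} {a' b' w' : ℂ →L[ℝ] ℂ} {z : ℂ}
    (ha : HasFDerivAt a a' z) (hb : HasFDerivAt b b' z) (hw : HasFDerivAt w w' z) (v : ℂ) :
    fderiv ℝ (fun ζ => Complex.exp (a ζ) * Complex.exp (b ζ / 2) * w ζ) z v =
      Complex.exp (a z) * Complex.exp (b z / 2) * (w' v + (a' v + b' v / 2) * w z) := by
  have hb2 : HasFDerivAt (fun ζ => b ζ / 2) ((2⁻¹ : ℂ) • b') z := by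
    simpa only [div_eq_mul_inv] using hb.mul_const (2⁻¹ : ℂ)
  have h := ((ha.cexp.mul hb2.cexp).mul hw).fderiv
  simp only [Pi.mul_def] at h
  rw [h]
  simp only [add_apply, smul_apply, smul_eq_mul]
  ring

/-- Derivative of the product `e^b w` in terms of the derivatives of its factors. -/
theorem HasFDerivAt.fderiv_cexp_mul {b w : ℂ → ℂ} {b' w' : ℂ →L[ℝ] ℂ} {z : ℂ}
    (hb : HasFDerivAt b b' z) (hw : HasFDerivAt w w' z) (v : ℂ) :
    fderiv ℝ (fun ζ => Complex.exp (b ζ) * w ζ) z v =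
      Complex.exp (b z) * (w' v + b' v * w z) := by
  have h := (hb.cexp.mul hw).fderiv
  simp only [Pi.mul_def] at h
  rw [h]
  simp only [add_apply, smul_apply, smul_eq_mul]
  ring

/-- Derivative of `z ↦ c z̄`. -/
theorem hasFDerivAt_const_mul_conj (c z : ℂ) :
    HasFDerivAt (fun ζ => c * starRingEnd ℂ ζ) (c • (Complex.conjCLE : ℂ →L[ℝ] ℂ)) z :=
  (Complex.conjCLE : ℂ →L[ℝ] ℂ).hasFDerivAt.const_mul c

/-- If `γ = e^φ` and `u₂` solves the admittivity equation, then
`M₁₂ = e^{ik z̄} e^{φ/2} ∂u₂` and `M₂₂ = e^{ik z̄} e^{φ/2} ∂̄u₂` satisfy the second column of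
the D-bar system `D_k M − Q M = 0`: `∂̄M₁₂ − ik M₁₂ = Q₁₂ M₂₂` and `∂M₂₂ = Q₂₁ M₁₂`. -/
theorem second_column_Dk_system (φ γ u₂ M₁₂ M₂₂ Q₁₂ Q₂₁ : ℂ → ℂ) (k : ℂ)
    (hφ : ContDiff ℝ 2 φ) (hγ : γ = fun z => Complex.exp (φ z))
    (hu : ContDiff ℝ 2 u₂)
    (hadm : ∀ z : ℂ, pdx (fun ζ => γ ζ * pdx u₂ ζ) z + pdy (fun ζ => γ ζ * pdy u₂ ζ) z = 0)
    (hM12 : M₁₂ = fun z =>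
      Complex.exp (Complex.I * k * (starRingEnd ℂ z)) * Complex.exp (φ z / 2) * wdz u₂ z)
    (hM22 : M₂₂ = fun z =>
      Complex.exp (Complex.I * k * (starRingEnd ℂ z)) * Complex.exp (φ z / 2) * wdbar u₂ z)
    (hQ12 : Q₁₂ = fun z => -(1 / 2 : ℂ) * wdz φ z)
    (hQ21 : Q₂₁ = fun z => -(1 / 2 : ℂ) * wdbar φ z) :
    ∀ z : ℂ,
      wdbar M₁₂ z - Complex.I * k * M₁₂ z = Q₁₂ z * M₂₂ z ∧
      wdz M₂₂ z = Q₂₁ z * M₁₂ z := by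
  intro z
  have hφ' : HasFDerivAt φ (fderiv ℝ φ z) z := (hφ.differentiable (by norm_num) z).hasFDerivAt
  have hD : HasFDerivAt (fderiv ℝ u₂) (fderiv ℝ (fderiv ℝ u₂) z) z :=
    ((hu.fderiv_right (m := 1) (by norm_num)).differentiable (by norm_num) z).hasFDerivAt
  set S := fderiv ℝ (fderiv ℝ u₂) z
  have hsymm : S 1 Complex.I = S Complex.I 1 :=
    (hu.contDiffAt.isSymmSndFDerivAt (by simp)).eq 1 Complex.I
  have hx : HasFDerivAt (pdx u₂) (S.flip 1) z := by
    simpa using! hD.clm_apply (hasFDerivAt_const (1 : ℂ) z)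
  have hy : HasFDerivAt (pdy u₂) (S.flip Complex.I) z := by
    simpa using! hD.clm_apply (hasFDerivAt_const Complex.I z)
  have hiy := hy.const_mul Complex.I
  have hdz : HasFDerivAt (wdz u₂) ((2⁻¹ : ℂ) • (S.flip 1 - Complex.I • S.flip Complex.I)) z := by
    simpa only [div_eq_mul_inv] using! (hx.sub hiy).mul_const (2⁻¹ : ℂ)
  have hdbar : HasFDerivAt (wdbar u₂) ((2⁻¹ : ℂ) • (S.flip 1 + Complex.I • S.flip Complex.I)) z := by
    simpa only [div_eq_mul_inv] using! (hx.add hiy).mul_const (2⁻¹ : ℂ)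
  have hE := hasFDerivAt_const_mul_conj (Complex.I * k) z
  have hdiv := hadm z
  subst hγ hM12 hM22 hQ12 hQ21
  rw [pdx, pdy, hφ'.fderiv_cexp_mul hx, hφ'.fderiv_cexp_mul hy] at hdiv
  simp only [pdx, pdy, ← mul_add,
    mul_eq_zero, Complex.exp_ne_zero, false_or, ContinuousLinearMap.flip_apply] at hdiv
  have h12 := hE.fderiv_cexp_mul_cexp_half_mul hφ' hdz
  have h22 := hE.fderiv_cexp_mul_cexp_half_mul hφ' hdbar
  constructor
  · rw [wdbar, pdx, pdy, h12, h12]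
    simp [wdz, wdbar, pdx, pdy, hsymm]
    linear_combination
      Complex.exp (Complex.I * k * starRingEnd ℂ z) * Complex.exp (φ z / 2) / 4 * hdiv
      + (Complex.exp (Complex.I * k * starRingEnd ℂ z) * Complex.exp (φ z / 2)) *
        (-(S Complex.I Complex.I) / 4 - fderiv ℝ φ z Complex.I * fderiv ℝ u₂ z Complex.I / 4
          - Complex.I * k * (fderiv ℝ u₂ z 1 - Complex.I * fderiv ℝ u₂ z Complex.I) / 4) *
        Complex.I_sq
  · rw [wdz, pdx, pdy, h22, h22]
    simp [wdz, wdbar, pdx, pdy, hsymm]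
    linear_combination
      Complex.exp (Complex.I * k * starRingEnd ℂ z) * Complex.exp (φ z / 2) / 4 * hdiv
      + (Complex.exp (Complex.I * k * starRingEnd ℂ z) * Complex.exp (φ z / 2)) *
        (-(S Complex.I Complex.I) / 4 - fderiv ℝ φ z Complex.I * fderiv ℝ u₂ z Complex.I / 4
          + Complex.I * k * (fderiv ℝ u₂ z 1 + Complex.I * fderiv ℝ u₂ z Complex.I) / 4) *
        Complex.I_sq
end
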